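/- Let T, T₂ ∈ ℚ⟦z⟧ be the formal power series T = ∑_{k≥1} k^{k-1} z^k/k! and T₂ = ∑_{k≥1} k^{k-2} z^k/k!, and let (H_n)_{n≥1} be the sequence of polynomials in ℚ[x] defined by H₁(x) = 1 and H_{n+1}(x) = (2n−1+(n−1)x)·H_n(x) + (1+x)²·H_n′(x). Then for every n ≥ 1, the n-th formal derivative of T₂ equals exp(n·T) · (1−T)^{−(n−1)} · H_n(T/(1−T)), where exp(n·T) = ∑_{k≥0} (nT)^k/k!, (1−T) is invertible since it has constant term 1, and H_n(T/(1−T)) denotes the evaluation of the polynomial H_n at the power series T/(1−T). -/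

import Mathlib

open PowerSeries Polynomial

/-- The tree function `T = ∑_{k≥1} k^{k-1} z^k / k!` as a formal power series over `ℚ`. -/
noncomputable def treeT : PowerSeries ℚ :=
  PowerSeries.mk fun k => if k = 0 then 0 else (k : ℚ) ^ (k - 1) / (Nat.factorial k)

/-- The series `T₂ = ∑_{k≥1} k^{k-2} z^k / k!` (EGF of unrooted Cayley trees). -/
noncomputable def treeT2 : PowerSeries ℚ :=
  PowerSeries.mk fun k => if k = 0 then 0 else (k : ℚ) ^ (k - 2) / (Nat.factorial k)

/-- The exponential `exp(S) = ∑_{k≥0} S^k / k!` of a power series `S` with zero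
constant term: the coefficient of `z^d` only involves `S^k` for `k ≤ d`. -/
noncomputable def expPS (S : PowerSeries ℚ) : PowerSeries ℚ :=
  PowerSeries.mk fun d => ∑ k ∈ Finset.range (d + 1),
    (PowerSeries.coeff d (S ^ k)) / (Nat.factorial k)


/-- Abel's binomial identity, `x = 1`. -/
theorem abel_aux (n : ℕ) :
    ∑ k ∈ Finset.range (n + 1), Polynomial.C ((n.choose k : ℚ) * ((k : ℚ) + 1) ^ (k - 1)) *
      (Polynomial.X + Polynomial.C ((n : ℚ) - k)) ^ (n - k)
      = ((Polynomial.X + Polynomial.C ((n : ℚ) + 1)) ^ n : Polynomial ℚ) := by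
  induction n with
  | zero => simp
  | succ n ih =>
    -- the derivative of the difference vanishes
    have hder : Polynomial.derivative (∑ k ∈ Finset.range (n + 1 + 1),
        Polynomial.C (((n + 1).choose k : ℚ) * ((k : ℚ) + 1) ^ (k - 1)) *
        (Polynomial.X + Polynomial.C (((n + 1 : ℕ) : ℚ) - k)) ^ (n + 1 - k)
        - (Polynomial.X + Polynomial.C (((n + 1 : ℕ) : ℚ) + 1)) ^ (n + 1)) = 0 := by
      have ih2 := congrArg (fun p => p.comp (Polynomial.X + Polynomial.C (1 : ℚ))) ih
      simp only [Polynomial.sum_comp, Polynomial.mul_comp, Polynomial.C_comp,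
        Polynomial.pow_comp, Polynomial.add_comp, Polynomial.X_comp] at ih2
      rw [Polynomial.derivative_sub, Polynomial.derivative_sum, Finset.sum_range_succ, sub_eq_zero]
      have h1 : Polynomial.derivative ((Polynomial.X + Polynomial.C (((n + 1 : ℕ) : ℚ) + 1)) ^ (n + 1))
          = Polynomial.C ((n : ℚ) + 1) * (Polynomial.X + Polynomial.C 1 + Polynomial.C ((n : ℚ) + 1)) ^ n := by
        rw [Polynomial.derivative_pow]
        simp [add_assoc, add_comm, add_left_comm]
      rw [h1, ← ih2, Finset.mul_sum]
      have h2 : Polynomial.derivative (Polynomial.C (((n + 1).choose (n + 1) : ℚ) * (((n + 1 : ℕ) : ℚ) + 1) ^ (n + 1 - 1)) *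
        (Polynomial.X + Polynomial.C (((n + 1 : ℕ) : ℚ) - ((n + 1 : ℕ) : ℚ))) ^ (n + 1 - (n + 1))) = 0 := by
        rw [Nat.sub_self, pow_zero, mul_one, Polynomial.derivative_C]
      rw [h2, add_zero]
      refine Finset.sum_congr rfl fun k hk => ?_
      have hk' : k ≤ n := by simpa [Nat.lt_succ_iff] using hk
      rw [Polynomial.derivative_mul, Polynomial.derivative_C, zero_mul, zero_add,
        Polynomial.derivative_pow]
      have e : n + 1 - k - 1 = n - k := by omega
      have hc : ((n + 1).choose k : ℚ) * ((n + 1 - k : ℕ) : ℚ) = ((n : ℚ) + 1) * n.choose k := by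
        have := Nat.choose_mul_succ_eq n k
        have h3 : ((n.choose k * (n + 1) : ℕ) : ℚ) = (((n + 1).choose k * (n + 1 - k) : ℕ) : ℚ) := by
          rw [this]
        push_cast at h3 ⊢
        linarith
      rw [e]
      have hX : (Polynomial.X + Polynomial.C (((n + 1 : ℕ) : ℚ) - k) : Polynomial ℚ)
          = Polynomial.X + Polynomial.C 1 + Polynomial.C ((n : ℚ) - k) := by
        rw [add_assoc, ← Polynomial.C_add]; congr 2; push_cast; ring
      rw [hX]
      simp only [Polynomial.derivative_add, Polynomial.derivative_X, Polynomial.derivative_C,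
        add_zero, mul_one]
      rw [← mul_assoc, ← mul_assoc, ← Polynomial.C_mul, ← Polynomial.C_mul]
      congr 2
      linear_combination ((k : ℚ) + 1) ^ (k - 1) * hc
    have hconst := Polynomial.eq_C_of_derivative_eq_zero hder
    have hev := congrArg (Polynomial.eval (-((n : ℚ) + 2))) hconst
    rw [Polynomial.eval_C] at hev
    rw [← sub_eq_zero, hconst, ← hev, ← Polynomial.C_0]
    congr 1
    rw [Polynomial.eval_sub, Polynomial.eval_finsetSum]
    have h0 : Polynomial.eval (-((n : ℚ) + 2))
        ((Polynomial.X + Polynomial.C (((n + 1 : ℕ) : ℚ) + 1)) ^ (n + 1)) = 0 := by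
      rw [Polynomial.eval_pow]
      apply pow_eq_zero_iff (Nat.succ_ne_zero n) |>.2
      simp; ring
    rw [h0, sub_zero]
    have hf := congrFun (fwdDiff_iter_pow_eq_zero_of_lt (R := ℚ) (Nat.lt_succ_self n)) 1
    rw [fwdDiff_iter_eq_sum_shift] at hf
    rw [Pi.zero_apply] at hf
    rw [← hf]
    refine Finset.sum_congr rfl fun k hk => ?_
    have hk' : k ≤ n + 1 := by simpa [Nat.lt_succ_iff] using hk
    simp only [Polynomial.eval_mul, Polynomial.eval_C, Polynomial.eval_pow, Polynomial.eval_add,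
      Polynomial.eval_X, Nat.succ_eq_add_one]
    have e1 : -((n : ℚ) + 2) + (((n + 1 : ℕ) : ℚ) - k) = (-1) * ((k : ℚ) + 1) := by
      push_cast; ring
    rw [e1, mul_pow]
    have e2 : ((k : ℚ) + 1) ^ (k - 1) * ((k : ℚ) + 1) ^ (n + 1 - k) = ((k : ℚ) + 1) ^ n := by
      rcases k with _ | k
      · simp
      · rw [← pow_add]; congr 1; omega
    simp only [zsmul_eq_mul, nsmul_eq_mul, mul_one]
    push_cast
    rw [add_comm (1 : ℚ) k, ← e2]
    ring

/-- The derivative of `T₂`. -/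
noncomputable def serG : PowerSeries ℚ :=
  PowerSeries.mk fun k => ((k : ℚ) + 1) ^ (k - 1) / (Nat.factorial k)

theorem treeT_eq : treeT = PowerSeries.X * serG := by
  ext k
  rcases k with _ | k
  · simp [treeT]
  · rw [PowerSeries.coeff_succ_X_mul]
    simp only [treeT, serG, PowerSeries.coeff_mk]
    rw [Nat.factorial_succ]
    rcases k with _ | k
    · simp
    · simp only [Nat.add_sub_cancel, Nat.succ_ne_zero, if_false]
      push_cast
      have : (k : ℚ) + 1 + 1 ≠ 0 := by positivity
      have h3 := Nat.factorial_ne_zero (k + 1)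
      have : ((k + 1).factorial : ℚ) ≠ 0 := by exact_mod_cast h3
      field_simp
      ring

theorem derivT2 : d⁄dX ℚ treeT2 = serG := by
  ext k
  rw [PowerSeries.coeff_derivative]
  simp only [treeT2, serG, PowerSeries.coeff_mk, Nat.succ_ne_zero, if_false]
  rw [Nat.factorial_succ]
  push_cast
  have : (k : ℚ) + 1 ≠ 0 := by positivity
  have : (k.factorial : ℚ) ≠ 0 := by exact_mod_cast Nat.factorial_ne_zero k
  field_simp

theorem derivG : d⁄dX ℚ serG = d⁄dX ℚ treeT * serG := by
  rw [mul_comm]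
  ext n
  rw [PowerSeries.coeff_derivative, PowerSeries.coeff_mul,
    Finset.Nat.sum_antidiagonal_eq_sum_range_succ_mk]
  have h := congrArg (Polynomial.eval 1) (abel_aux n)
  rw [Polynomial.eval_finsetSum] at h
  simp only [Polynomial.eval_mul, Polynomial.eval_C, Polynomial.eval_pow, Polynomial.eval_add,
      Polynomial.eval_X] at h
  have hn : (n.factorial : ℚ) ≠ 0 := by exact_mod_cast Nat.factorial_ne_zero n
  have hl : PowerSeries.coeff (n + 1) serG * ((n : ℚ) + 1)
      = (1 + ((n : ℚ) + 1)) ^ n / n.factorial := by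
    simp only [serG, PowerSeries.coeff_mk, Nat.factorial_succ, Nat.add_sub_cancel]
    have : (n : ℚ) + 1 ≠ 0 := by positivity
    push_cast
    field_simp
    ring
  rw [hl, ← h, Finset.sum_div]
  refine Finset.sum_congr rfl fun k hk => ?_
  have hk' : k ≤ n := by simpa [Nat.lt_succ_iff] using hk
  simp only [PowerSeries.coeff_derivative, serG, treeT, PowerSeries.coeff_mk, Nat.succ_ne_zero,
    if_false, Nat.add_sub_cancel]
  rw [Nat.cast_choose ℚ hk', Nat.factorial_succ]
  have h1 : (k.factorial : ℚ) ≠ 0 := by exact_mod_cast Nat.factorial_ne_zero k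
  have h2 : ((n - k).factorial : ℚ) ≠ 0 := by exact_mod_cast Nat.factorial_ne_zero (n - k)
  have h3 : ((n - k : ℕ) : ℚ) + 1 ≠ 0 := by positivity
  have h4 : (1 : ℚ) + ((n : ℚ) - k) = ((n - k : ℕ) : ℚ) + 1 := by
    rw [Nat.cast_sub hk']; ring
  rw [h4]
  push_cast [-Nat.cast_sub]
  field_simp

theorem constT : PowerSeries.constantCoeff treeT = 0 := by
  rw [treeT_eq]; simp

theorem constG : PowerSeries.constantCoeff serG = 1 := by
  rw [← PowerSeries.coeff_zero_eq_constantCoeff_apply]; simp [serG]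

theorem expPS_eq_subst (S : PowerSeries ℚ) (hS : PowerSeries.constantCoeff S = 0) :
    expPS S = (PowerSeries.exp ℚ).subst S := by
  ext d
  rw [PowerSeries.coeff_subst' (PowerSeries.HasSubst.of_constantCoeff_zero' hS)]
  rw [finsum_eq_sum_of_support_subset (s := Finset.range (d + 1))]
  · simp only [expPS, PowerSeries.coeff_mk, PowerSeries.coeff_exp]
    refine Finset.sum_congr rfl fun k _ => ?_
    simp [div_eq_mul_inv, mul_comm]
  · intro k hk
    by_contra hkd
    apply hk
    have hkd' : d < k := by simpa using hkd
    have : PowerSeries.coeff d (S ^ k) = 0 := by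
      apply PowerSeries.coeff_of_lt_order
      refine lt_of_lt_of_le ?_ (PowerSeries.le_order_pow_of_constantCoeff_eq_zero k hS)
      exact_mod_cast hkd'
    simp [this]

theorem ode_unique (a f g : PowerSeries ℚ) (hf : d⁄dX ℚ f = a * f) (hg : d⁄dX ℚ g = a * g)
    (hf0 : PowerSeries.constantCoeff f = 1) (hg0 : PowerSeries.constantCoeff g = 1) : f = g := by
  have hgi : g * g⁻¹ = 1 := PowerSeries.mul_inv_cancel g (by rw [hg0]; exact one_ne_zero)
  have h : f * g⁻¹ = 1 := by
    apply PowerSeries.derivative.ext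
    · rw [Derivation.leibniz, PowerSeries.derivative_inv', hf, hg, PowerSeries.derivative_one]
      simp only [smul_eq_mul]
      linear_combination (-f * a * g⁻¹) * hgi
    · simp [hf0, hg0]
  calc f = f * g⁻¹ * g := by rw [mul_assoc, mul_comm g⁻¹, hgi, mul_one]
    _ = g := by rw [h, one_mul]

theorem expPS_nT (n : ℕ) : expPS (n • treeT) = serG ^ n := by
  have hc : PowerSeries.constantCoeff (n • treeT) = 0 := by rw [map_nsmul, constT, smul_zero]
  have hs := PowerSeries.HasSubst.of_constantCoeff_zero' hc
  apply ode_unique (d⁄dX ℚ (n • treeT))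
  · rw [expPS_eq_subst _ hc, PowerSeries.derivative_subst hs, PowerSeries.derivative_exp, mul_comm]
  · rw [PowerSeries.derivative_pow, derivG, map_nsmul]
    rcases n with _ | n
    · simp
    · simp only [Nat.add_sub_cancel, nsmul_eq_mul]
      ring
  · rw [← PowerSeries.coeff_zero_eq_constantCoeff_apply]; simp [expPS]
  · rw [map_pow, constG, one_pow]

theorem u_mul : (1 - treeT) * (1 - treeT)⁻¹ = 1 :=
  PowerSeries.mul_inv_cancel _ (by simp [constT])

theorem derivT : d⁄dX ℚ treeT = serG * (1 - treeT)⁻¹ := by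
  have h : d⁄dX ℚ treeT = serG + treeT * d⁄dX ℚ treeT := by
    conv_lhs => rw [treeT_eq]
    rw [Derivation.leibniz, PowerSeries.derivative_X, derivG]
    simp only [smul_eq_mul]
    linear_combination (-d⁄dX ℚ treeT) * treeT_eq
  linear_combination (1 - treeT)⁻¹ * h - d⁄dX ℚ treeT * u_mul

theorem derivU : d⁄dX ℚ (1 - treeT)⁻¹ = serG * (1 - treeT)⁻¹ ^ 3 := by
  rw [PowerSeries.derivative_inv', map_sub, PowerSeries.derivative_one, derivT]
  ring

theorem stmt_2 (H : ℕ → Polynomial ℚ) (hH1 : H 1 = 1)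
    (hHrec : ∀ n : ℕ, 1 ≤ n → H (n + 1) =
      (Polynomial.C (2 * (n : ℚ) - 1) + Polynomial.C ((n : ℚ) - 1) * Polynomial.X) * H n
        + (1 + Polynomial.X) ^ 2 * Polynomial.derivative (H n)) :
    ∀ n : ℕ, 1 ≤ n →
      (PowerSeries.derivativeFun (R := ℚ))^[n] treeT2 =
        expPS (n • treeT) * ((1 - treeT)⁻¹) ^ (n - 1) *
          Polynomial.aeval (treeT * (1 - treeT)⁻¹) (H n) := by
  intro n hn
  rw [expPS_nT]
  induction n, hn using Nat.le_induction with
  | base =>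
    rw [hH1]
    simp only [Function.iterate_one, pow_one, Nat.sub_self, pow_zero, mul_one, map_one]
    exact derivT2
  | succ n hn ih =>
    rw [Function.iterate_succ_apply', ih]
    obtain ⟨m, rfl⟩ : ∃ m, n = m + 1 := ⟨n - 1, by omega⟩
    change d⁄dX ℚ _ = _
    rw [hHrec _ hn]
    have hu := u_mul
    have hT := derivT
    have hU := derivU
    have hG := derivG
    set u := (1 - treeT)⁻¹ with hudef
    have hch : d⁄dX ℚ (Polynomial.aeval (treeT * u) (H (m + 1)))
        = Polynomial.aeval (treeT * u) (Polynomial.derivative (H (m + 1))) *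
          d⁄dX ℚ (treeT * u) := by
      rw [Derivation.map_aeval, smul_eq_mul]
    have hx : d⁄dX ℚ (treeT * u) = serG * u ^ 3 := by
      rw [Derivation.leibniz, hU, hT]
      simp only [smul_eq_mul]
      linear_combination (-serG * u ^ 2) * hu
    have hpu : d⁄dX ℚ (u ^ m) = (m : PowerSeries ℚ) * (serG * u ^ (m + 2)) := by
      rw [PowerSeries.derivative_pow, hU]
      rcases m with _ | m
      · simp
      · simp only [Nat.add_sub_cancel]; ring
    have hpG : d⁄dX ℚ (serG ^ (m + 1)) = ((m : PowerSeries ℚ) + 1) * (serG ^ (m + 2) * u) := by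
      rw [PowerSeries.derivative_pow, hG, hT]
      simp only [Nat.add_sub_cancel]; push_cast; ring
    simp only [Nat.add_sub_cancel]
    rw [Derivation.leibniz, Derivation.leibniz, hch, hx, hpu, hpG]
    simp only [smul_eq_mul, map_add, map_mul, map_pow, map_one, Polynomial.aeval_X,
      Polynomial.aeval_C]
    have c1 : algebraMap ℚ (PowerSeries ℚ) (2 * ((m + 1 : ℕ) : ℚ) - 1)
        = 2 * (m : PowerSeries ℚ) + 1 := by
      have : (2 * ((m + 1 : ℕ) : ℚ) - 1) = (m : ℚ) + m + 1 := by push_cast; ring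
      rw [this, map_add, map_add, map_one, map_natCast]; ring
    have c2 : algebraMap ℚ (PowerSeries ℚ) (((m + 1 : ℕ) : ℚ) - 1) = (m : PowerSeries ℚ) := by
      have : (((m + 1 : ℕ) : ℚ) - 1) = (m : ℚ) := by push_cast; ring
      rw [this]; simp
    rw [c1, c2]
    have hx1 : treeT * u = u - 1 := by linear_combination -hu
    generalize Polynomial.aeval (treeT * u) (H (m + 1)) = P
    generalize Polynomial.aeval (treeT * u) (Polynomial.derivative (H (m + 1))) = Q
    rw [hx1]
    ring
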